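/- Let q, x be complex numbers with |q| < 1. Then Σ_{n=0}^{∞} Σ_{k=0}^{∞} q^{n²+2nk+k(k+1)} x^{n+k} · [n+k choose k]_{q²} / (q²;q²)_{n+k} = Σ_{n=0}^{∞} q^{n²} x^n / (q;q)_n, where both series converge absolutely under these hypotheses. -/

import Mathlib

open scoped BigOperators

/-- The finite q-Pochhammer symbol `(a;q)_n = ∏_{i=0}^{n-1} (1 - a q^i)`. -/
noncomputable def qPoch (a q : ℂ) (n : ℕ) : ℂ := ∏ i ∈ Finset.range n, (1 - a * q ^ i)

/-- The Gaussian (q-binomial) coefficient `[n choose k]_q`, equal to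
`(q;q)_n / ((q;q)_{n-k} (q;q)_k)` when `0 ≤ k ≤ n` and `0` otherwise. -/
noncomputable def qBinom (q : ℂ) (n k : ℤ) : ℂ :=
  if 0 ≤ k ∧ k ≤ n then
    qPoch q q n.toNat / (qPoch q q (n - k).toNat * qPoch q q k.toNat)
  else 0

lemma qPoch_zero (a q : ℂ) : qPoch a q 0 = 1 := by simp [qPoch]

lemma qPoch_succ (a q : ℂ) (n : ℕ) : qPoch a q (n + 1) = qPoch a q n * (1 - a * q ^ n) := by
  simp [qPoch, Finset.prod_range_succ]

/-- Each factor of `(p;p)_n` has modulus at least `1 - r` when `‖p‖ ≤ r ≤ 1`. -/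
lemma one_sub_le_norm_one_sub_mul_pow {p : ℂ} {r : ℝ} (hp : ‖p‖ ≤ r) (hr : r ≤ 1) (n : ℕ) :
    1 - r ≤ ‖1 - p * p ^ n‖ := by
  have h1 : ‖p * p ^ n‖ ≤ r := by
    rw [norm_mul, norm_pow]
    exact (mul_le_of_le_one_right (norm_nonneg p)
      (pow_le_one₀ (norm_nonneg p) (hp.trans hr))).trans hp
  have h2 := norm_sub_norm_le (1 : ℂ) (p * p ^ n)
  rw [norm_one] at h2
  linarith

lemma one_sub_mul_pow_ne_zero {p : ℂ} (hp : ‖p‖ < 1) (n : ℕ) : 1 - p * p ^ n ≠ 0 := by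
  have h := one_sub_le_norm_one_sub_mul_pow le_rfl hp.le n
  exact norm_pos_iff.mp (by linarith)

lemma qPoch_self_ne_zero {p : ℂ} (hp : ‖p‖ < 1) (n : ℕ) : qPoch p p n ≠ 0 :=
  Finset.prod_ne_zero_iff.mpr fun i _ => one_sub_mul_pow_ne_zero hp i

lemma pow_le_norm_qPoch_self {p : ℂ} {r : ℝ} (hp : ‖p‖ ≤ r) (hr : r ≤ 1) (n : ℕ) :
    (1 - r) ^ n ≤ ‖qPoch p p n‖ := by
  induction n with
  | zero => simp [qPoch_zero]
  | succ n ih =>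
    rw [qPoch_succ, norm_mul, pow_succ]
    exact mul_le_mul ih (one_sub_le_norm_one_sub_mul_pow hp hr n) (by linarith) (norm_nonneg _)

/-- The generating function `∑ t^n / (p;p)_n`. -/
noncomputable def qExpSeries (p : ℂ) : PowerSeries ℂ := PowerSeries.mk fun n => (qPoch p p n)⁻¹

lemma qExpSeries_sub_rescale {p : ℂ} (hp : ‖p‖ < 1) :
    qExpSeries p - PowerSeries.rescale p (qExpSeries p) = PowerSeries.X * qExpSeries p := by
  ext n
  cases n with
  | zero =>
    rw [map_sub, PowerSeries.coeff_rescale, PowerSeries.coeff_zero_X_mul]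
    simp
  | succ n =>
    have h1 := qPoch_self_ne_zero hp n
    have h2 := one_sub_mul_pow_ne_zero hp n
    simp only [qExpSeries, map_sub, PowerSeries.coeff_rescale, PowerSeries.coeff_mk,
      PowerSeries.coeff_succ_X_mul, qPoch_succ]
    field_simp
    ring

/-- `∑_{n+k=N} q^k / ((q²;q²)_n (q²;q²)_k) = 1 / (q;q)_N`. -/
lemma sum_antidiagonal_pow_mul_inv_qPoch {q : ℂ} (hq : ‖q‖ < 1) (N : ℕ) :
    ∑ ij ∈ Finset.HasAntidiagonal.antidiagonal N,
      (qPoch (q ^ 2) (q ^ 2) ij.1)⁻¹ * (q ^ ij.2 * (qPoch (q ^ 2) (q ^ 2) ij.2)⁻¹) =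
      (qPoch q q N)⁻¹ := by
  have hq2 : ‖q ^ 2‖ < 1 := by
    rw [norm_pow]; exact pow_lt_one₀ (norm_nonneg q) hq two_ne_zero
  set A := qExpSeries (q ^ 2) with hA
  set P := A * PowerSeries.rescale q A with hP
  have hfun : P - PowerSeries.rescale q P = PowerSeries.X * P := by
    have h := qExpSeries_sub_rescale hq2
    rw [← hA] at h
    have h2 : PowerSeries.rescale q (PowerSeries.rescale q A) =
        PowerSeries.rescale (q ^ 2) A := by
      rw [PowerSeries.rescale_rescale, sq]
    rw [hP, map_mul, h2, ← mul_assoc, ← h]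
    ring
  have hcoeff : PowerSeries.coeff N P = (qPoch q q N)⁻¹ := by
    induction N with
    | zero =>
      rw [hP, PowerSeries.coeff_mul, Finset.HasAntidiagonal.antidiagonal_zero]
      simp only [Finset.sum_singleton, PowerSeries.coeff_rescale, hA, qExpSeries,
        PowerSeries.coeff_mk, qPoch_zero]
      simp
    | succ n ih =>
      have h := congrArg (PowerSeries.coeff (n + 1)) hfun
      simp only [map_sub, PowerSeries.coeff_rescale, PowerSeries.coeff_succ_X_mul, ih] at h
      have h1 := qPoch_self_ne_zero hq n
      have h2 := one_sub_mul_pow_ne_zero hq n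
      rw [qPoch_succ, mul_inv, ← h]
      field_simp
      ring
  rw [← hcoeff, hP, PowerSeries.coeff_mul]
  simp [hA, qExpSeries]

lemma summable_pow_sq_mul_pow {r : ℝ} (hr0 : 0 ≤ r) (hr1 : r < 1) {y : ℝ} (hy : 0 ≤ y) :
    Summable fun n : ℕ => r ^ (n ^ 2) * y ^ n := by
  have ht : Filter.Tendsto (fun n : ℕ => r ^ n * y) Filter.atTop (nhds 0) := by
    simpa using (tendsto_pow_atTop_nhds_zero_of_lt_one hr0 hr1).mul_const y
  refine Summable.of_norm_bounded_eventually_nat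
    (summable_geometric_of_lt_one (r := 1 / 2) (by norm_num) (by norm_num)) ?_
  filter_upwards [ht.eventually_le_const (by norm_num : (0 : ℝ) < 1 / 2)] with n hn
  rw [Real.norm_of_nonneg (by positivity), sq, pow_mul, ← mul_pow]
  exact pow_le_pow_left₀ (by positivity) hn n

lemma qBinom_add_div_qPoch {p : ℂ} (hp : ‖p‖ < 1) (n k : ℕ) :
    qBinom p (n + k) k / qPoch p p (n + k) = (qPoch p p n)⁻¹ * (qPoch p p k)⁻¹ := by
  have h := qPoch_self_ne_zero hp (n + k)
  have hcond : (0 : ℤ) ≤ k ∧ (k : ℤ) ≤ n + k := by omega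
  have h1 : ((n : ℤ) + k).toNat = n + k := by omega
  have h2 : ((n : ℤ) + k - k).toNat = n := by omega
  rw [qBinom, if_pos hcond, h1, h2, Int.toNat_natCast]
  field_simp

lemma dissection_term_eq {q : ℂ} (hq : ‖q‖ < 1) (x : ℂ) (n k : ℕ) :
    q ^ (n ^ 2 + 2 * n * k + k * (k + 1)) * x ^ (n + k) *
        qBinom (q ^ 2) (n + k) k / qPoch (q ^ 2) (q ^ 2) (n + k) =
      q ^ ((n + k) ^ 2) * x ^ (n + k) *
        ((qPoch (q ^ 2) (q ^ 2) n)⁻¹ * (q ^ k * (qPoch (q ^ 2) (q ^ 2) k)⁻¹)) := by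
  have hq2 : ‖q ^ 2‖ < 1 := by
    rw [norm_pow]; exact pow_lt_one₀ (norm_nonneg q) hq two_ne_zero
  rw [mul_div_assoc, qBinom_add_div_qPoch hq2,
    show n ^ 2 + 2 * n * k + k * (k + 1) = (n + k) ^ 2 + k by ring, pow_add q]
  ring

lemma summable_norm_ramanujan {q : ℂ} (hq : ‖q‖ < 1) (x : ℂ) :
    Summable fun n : ℕ => ‖q ^ (n ^ 2) * x ^ n / qPoch q q n‖ := by
  have hd : 0 < 1 - ‖q‖ := sub_pos.mpr hq
  refine Summable.of_nonneg_of_le (fun _ => norm_nonneg _) (fun n => ?_)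
    (summable_pow_sq_mul_pow (norm_nonneg q) hq (div_nonneg (norm_nonneg x) hd.le))
  rw [norm_div, norm_mul, norm_pow, norm_pow, div_pow, ← mul_div_assoc]
  have := pow_le_norm_qPoch_self le_rfl hq.le n
  gcongr

lemma summable_norm_dissection {q : ℂ} (hq : ‖q‖ < 1) (x : ℂ) :
    Summable fun p : ℕ × ℕ =>
      ‖q ^ (p.1 ^ 2 + 2 * p.1 * p.2 + p.2 * (p.2 + 1)) * x ^ (p.1 + p.2) *
        qBinom (q ^ 2) (p.1 + p.2) p.2 / qPoch (q ^ 2) (q ^ 2) (p.1 + p.2)‖ := by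
  have hd : 0 < 1 - ‖q‖ := sub_pos.mpr hq
  have hq2 : ‖q ^ 2‖ ≤ ‖q‖ := by
    rw [norm_pow]; exact pow_le_of_le_one (norm_nonneg q) hq.le two_ne_zero
  have hs := summable_pow_sq_mul_pow (norm_nonneg q) hq (div_nonneg (norm_nonneg x) hd.le)
  refine Summable.of_nonneg_of_le (fun _ => norm_nonneg _) (fun p => ?_)
    (hs.mul_of_nonneg hs (fun _ => by positivity) (fun _ => by positivity))
  obtain ⟨n, k⟩ := p
  dsimp only
  rw [dissection_term_eq hq]
  have hn := pow_le_norm_qPoch_self hq2 hq.le n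
  have hk := pow_le_norm_qPoch_self hq2 hq.le k
  have hexp : ‖q‖ ^ ((n + k) ^ 2) ≤ ‖q‖ ^ (n ^ 2 + k ^ 2) :=
    pow_le_pow_of_le_one (norm_nonneg q) hq.le (by nlinarith [Nat.zero_le (n * k)])
  have hqk : ‖q‖ ^ k ≤ 1 := pow_le_one₀ (norm_nonneg q) hq.le
  simp only [norm_mul, norm_pow, norm_inv] at *
  calc ‖q‖ ^ ((n + k) ^ 2) * ‖x‖ ^ (n + k) *
        (‖qPoch (q ^ 2) (q ^ 2) n‖⁻¹ * (‖q‖ ^ k * ‖qPoch (q ^ 2) (q ^ 2) k‖⁻¹))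
      ≤ ‖q‖ ^ (n ^ 2 + k ^ 2) * ‖x‖ ^ (n + k) *
        (((1 - ‖q‖) ^ n)⁻¹ * (1 * ((1 - ‖q‖) ^ k)⁻¹)) := by gcongr
    _ = _ := by
      rw [pow_add, pow_add, div_pow, div_pow]
      ring

/-- The sum of an absolutely convergent double series can be taken along antidiagonals. -/
lemma tsum_tsum_eq_tsum_sum_antidiagonal {f : ℕ × ℕ → ℂ} (hf : Summable f) :
    ∑' n, ∑' k, f (n, k) = ∑' N, ∑ ij ∈ Finset.HasAntidiagonal.antidiagonal N, f ij := by
  rw [← hf.tsum_prod, ← Finset.HasAntidiagonal.sigmaAntidiagonalEquivProd.tsum_eq f]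
  have hs := (Finset.HasAntidiagonal.sigmaAntidiagonalEquivProd (A := ℕ)).summable_iff.mpr hf
  refine (hs.tsum_sigma).trans (tsum_congr fun N => ?_)
  rw [tsum_fintype]
  exact Finset.sum_coe_sort (Finset.HasAntidiagonal.antidiagonal N) f

/-- The dissection of the Ramanujan function: for `|q| < 1`,
`Σ_{n,k≥0} q^{n²+2nk+k(k+1)} x^{n+k} [n+k choose k]_{q²} / (q²;q²)_{n+k}
 = Σ_{n≥0} q^{n²} x^n / (q;q)_n`, both series converging absolutely. -/
theorem stmt11 (q x : ℂ) (hq : ‖q‖ < 1) :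
    Summable (fun p : ℕ × ℕ =>
      ‖q ^ (p.1 ^ 2 + 2 * p.1 * p.2 + p.2 * (p.2 + 1)) * x ^ (p.1 + p.2) *
        qBinom (q ^ 2) (p.1 + p.2) p.2 / qPoch (q ^ 2) (q ^ 2) (p.1 + p.2)‖) ∧
    Summable (fun n : ℕ => ‖q ^ (n ^ 2) * x ^ n / qPoch q q n‖) ∧
    (∑' n : ℕ, ∑' k : ℕ, q ^ (n ^ 2 + 2 * n * k + k * (k + 1)) * x ^ (n + k) *
        qBinom (q ^ 2) (n + k) k / qPoch (q ^ 2) (q ^ 2) (n + k))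
    = ∑' n : ℕ, q ^ (n ^ 2) * x ^ n / qPoch q q n := by
  refine ⟨summable_norm_dissection hq x, summable_norm_ramanujan hq x, ?_⟩
  refine (tsum_tsum_eq_tsum_sum_antidiagonal (summable_norm_dissection hq x).of_norm).trans
    (tsum_congr fun N => ?_)
  rw [div_eq_mul_inv, ← sum_antidiagonal_pow_mul_inv_qPoch hq, Finset.mul_sum]
  refine Finset.sum_congr rfl fun ij hij => ?_
  rw [dissection_term_eq hq, Finset.HasAntidiagonal.mem_antidiagonal.mp hij]
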